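/- Let p and q be distinct odd primes, and let G be a finite group of minimal order with respect to the property that G contains an element whose order is divisible by p·q but every element of G \ Frat(G) has order divisible by some prime other than p and q (i.e., Ω_{p,q}(G) ≠ ∅ and Ω**_{p,q}(G) = ∅). Then Frat(G) = P × Q, where P is the Sylow p-subgroup and Q is the Sylow q-subgroup of Frat(G); P and Q are the unique minimal normal subgroups of G; and C_G(P) = C_G(Q) = Frat(G). In particular, P and Q are faithful irreducible modules for X = G/Frat(G). -/

import Mathlib

/-- `Ω_{p,q}(G) ≠ ∅` and `Ω**_{p,q}(G) = ∅`: `G` has an element of order divisible by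
`p·q`, but every element of `G` whose order is divisible by `p·q` and by no prime other
than `p` and `q` lies in the Frattini subgroup. -/
def OmegaBad (p q : ℕ) (G : Type*) [Group G] : Prop :=
  (∃ g : G, p * q ∣ orderOf g) ∧
    ∀ g : G, (p * q ∣ orderOf g ∧ ∀ r : ℕ, r.Prime → r ∣ orderOf g → r = p ∨ r = q) →
      g ∈ frattini G

/-- `N` is a minimal normal subgroup of `G`. -/
def IsMinimalNormal {G : Type*} [Group G] (N : Subgroup G) : Prop :=
  N.Normal ∧ N ≠ ⊥ ∧ ∀ M : Subgroup G, M.Normal → M ≤ N → M = ⊥ ∨ M = N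

/-- Two complements of an abelian normal Hall subgroup are conjugate. -/
theorem exists_conj_of_isComplement' {G : Type*} [Group G] [Finite G] {N : Subgroup G}
    [N.Normal] [IsMulCommutative N] (hN : (Nat.card N).Coprime N.index) {K L : Subgroup G}
    (hK : N.IsComplement' K) (hL : N.IsComplement' L) :
    ∃ n ∈ N, K.map (MulAut.conj n).toMonoidHom = L := by
  have key : ∀ {M : Subgroup G}, N.IsComplement' M →
      ∃ α : N.QuotientDiff, MulAction.stabilizer G α = M := by
    intro M hM
    let α : N.QuotientDiff := Quotient.mk'' ⟨(M : Set G), hM.symm⟩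
    refine ⟨α, (Subgroup.eq_of_le_of_card_ge ?_ ?_).symm⟩
    · intro m hm
      rw [MulAction.mem_stabilizer_iff]
      refine congrArg Quotient.mk'' (Subtype.ext ?_)
      exact op_smul_coe_set (inv_mem hm)
    · have h₁ := hM.card_mul_card
      have h₂ := (Subgroup.isComplement'_stabilizer_of_coprime (α := α) hN).card_mul_card
      exact (Nat.eq_of_mul_eq_mul_left Nat.card_pos (h₂.trans h₁.symm)).le
  obtain ⟨α, rfl⟩ := key hK
  obtain ⟨β, rfl⟩ := key hL
  obtain ⟨n, rfl⟩ := Subgroup.exists_smul_eq hN α β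
  exact ⟨n, n.2, (MulAction.stabilizer_smul_eq_stabilizer_map_conj (n : G) α).symm⟩

/-- An abelian normal subgroup of `G` contained in the Frattini subgroup, and which is a Hall
subgroup of a normal subgroup `C`, has a complement in `C` that is normal in `G`. -/
theorem exists_normal_complement_of_le_frattini {G : Type*} [Group G] [Finite G]
    {N C : Subgroup G} [N.Normal] [IsMulCommutative N] [C.Normal] (hNF : N ≤ frattini G)
    (hNC : N ≤ C) (hcop : (Nat.card N).Coprime (N.relIndex C)) :
    ∃ K : Subgroup G, K.Normal ∧ N ⊓ K = ⊥ ∧ N ⊔ K = C := by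
  have hcop' : (Nat.card (N.subgroupOf C)).Coprime (N.subgroupOf C).index := by
    rwa [Nat.card_congr (Subgroup.subgroupOfEquivOfLe hNC).toEquiv]
  obtain ⟨K, hK⟩ := Subgroup.exists_right_complement'_of_coprime hcop'
  have hsup : N ⊔ K.map C.subtype = C := by
    have := congrArg (Subgroup.map C.subtype) hK.sup_eq_top
    rwa [Subgroup.map_sup, Subgroup.subgroupOf_map_subtype, inf_eq_left.mpr hNC,
      ← MonoidHom.range_eq_map, Subgroup.range_subtype] at this
  have hinf : N ⊓ K.map C.subtype = ⊥ := by
    have := congrArg (Subgroup.map C.subtype) hK.disjoint.eq_bot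
    rwa [Subgroup.map_inf _ _ _ C.subtype_injective, Subgroup.subgroupOf_map_subtype,
      inf_eq_left.mpr hNC, Subgroup.map_bot] at this
  refine ⟨K.map C.subtype, ?_, hinf, hsup⟩
  rw [← Subgroup.normalizer_eq_top_iff]
  refine frattini_nongenerating (eq_top_iff.mpr fun g _ => ?_)
  let φ : MulAut C := MulAut.conjNormal g
  have hφN : (N.subgroupOf C).map φ.toMonoidHom = N.subgroupOf C := by
    ext x
    simp only [Subgroup.mem_map, Subgroup.mem_subgroupOf]
    constructor
    · rintro ⟨y, hy, rfl⟩
      exact Subgroup.Normal.conj_mem ‹N.Normal› _ hy g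
    · intro hx
      refine ⟨φ.symm x, ?_, φ.apply_symm_apply x⟩
      have := Subgroup.Normal.conj_mem ‹N.Normal› _ hx g⁻¹
      simpa [φ, MulAut.conjNormal_symm_apply] using this
  have hφK : (N.subgroupOf C).IsComplement' (K.map φ.toMonoidHom) := by
    refine Subgroup.isComplement'_of_card_mul_and_disjoint ?_ ?_
    · rw [Nat.card_congr (K.equivMapOfInjective φ.toMonoidHom φ.injective).symm.toEquiv]
      exact hK.card_mul_card
    · rw [← hφN]
      exact (Subgroup.disjoint_map φ.injective hK.disjoint)
  obtain ⟨n, hn, hnK⟩ := exists_conj_of_isComplement' hcop' hφK hK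
  have hng : (n : G) * g ∈ Subgroup.normalizer (K.map C.subtype : Set G) := by
    rw [Subgroup.mem_normalizer_iff_map_conj_eq]
    have h := congrArg (Subgroup.map C.subtype) hnK
    rw [Subgroup.map_map, Subgroup.map_map] at h
    rw [Subgroup.map_map]
    refine Eq.trans (congrArg (K.map ·) ?_) h
    ext x
    simp [φ, mul_assoc]
  rw [show g = (n : G) * g * (g⁻¹ * (n : G)⁻¹ * g) by group]
  refine Subgroup.mul_mem_sup hng (hNF ?_)
  simpa using Subgroup.Normal.conj_mem ‹N.Normal› _ (inv_mem (Subgroup.mem_subgroupOf.mp hn)) g⁻¹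

/-- If the elements of `G` whose order is a product of powers of `p` and `q`, divisible by both,
lie in the Frattini subgroup, then every quotient of `G` with elements of order divisible by
`p * q` inherits the property. -/
theorem OmegaBad.quotient {p q : ℕ} {G : Type*} [Group G] [Finite G] (hp : p.Prime)
    (hq : q.Prime) (hbad : OmegaBad p q G) (N : Subgroup G) [N.Normal] {x : G ⧸ N}
    (hx : p * q ∣ orderOf x) : OmegaBad p q (G ⧸ N) := by
  refine ⟨⟨x, hx⟩, fun y ⟨hy, hy'⟩ => ?_⟩
  obtain ⟨g, rfl⟩ := QuotientGroup.mk'_surjective N y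
  have hg0 : orderOf g ≠ 0 := (orderOf_pos g).ne'
  obtain ⟨e, n, hpn, hn⟩ := Nat.exists_eq_pow_mul_and_not_dvd hg0 p hp.ne_one
  have hn0 : n ≠ 0 := by rintro rfl; simp at hpn
  obtain ⟨f, b, hqb, hb⟩ := Nat.exists_eq_pow_mul_and_not_dvd hn0 q hq.ne_one
  have hb0 : b ≠ 0 := by rintro rfl; simp at hqb
  have hpb : ¬ p ∣ b := fun h => hpn (hb ▸ h.mul_left _)
  have hg : orderOf g = p ^ e * q ^ f * b := by rw [hn, hb, mul_assoc]
  have hcop : b.Coprime (orderOf (QuotientGroup.mk' N g)) := by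
    refine Nat.Coprime.symm (Nat.coprime_of_dvd fun r hr h₁ h₂ => ?_)
    rcases hy' r hr h₁ with rfl | rfl
    exacts [hpb h₂, hqb h₂]
  have hgb : orderOf (g ^ b) = p ^ e * q ^ f := by
    rw [orderOf_pow_of_dvd hb0 (hg ▸ Dvd.intro_left _ rfl), hg, Nat.mul_div_cancel _ hb0.bot_lt]
  have hmem : g ^ b ∈ frattini G := by
    refine hbad.2 _ ⟨?_, fun r hr h => ?_⟩
    · rw [hgb]
      refine hy.trans (hcop.symm.dvd_of_dvd_mul_right ?_)
      rw [← hg]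
      exact orderOf_map_dvd _ _
    · rw [hgb, hr.dvd_mul] at h
      exact h.imp (fun h => (Nat.prime_dvd_prime_iff_eq hr hp).mp (hr.dvd_of_dvd_pow h))
        fun h => (Nat.prime_dvd_prime_iff_eq hr hq).mp (hr.dvd_of_dvd_pow h)
  have hmem' := frattini_le_comap_frattini_of_surjective (QuotientGroup.mk'_surjective N) hmem
  rw [Subgroup.mem_comap, map_pow] at hmem'
  obtain ⟨m, hm⟩ := exists_pow_eq_self_of_coprime hcop
  rw [← hm]
  exact pow_mem hmem' m

/-- Commuting elements of orders divisible by distinct primes `p` and `q` yield an element of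
order divisible by `p * q`. -/
theorem exists_mul_dvd_orderOf_of_commute {p q : ℕ} {G : Type*} [Group G] [Finite G]
    (hpq : p.Coprime q) {x y : G} (hxy : Commute x y) (hx : p ∣ orderOf x)
    (hy : q ∣ orderOf y) : ∃ z : G, p * q ∣ orderOf z := by
  refine ⟨x ^ (orderOf x / p) * y ^ (orderOf y / q), ?_⟩
  have h₁ := orderOf_pow_orderOf_div (orderOf_pos x).ne' hx
  have h₂ := orderOf_pow_orderOf_div (orderOf_pos y).ne' hy
  rw [(hxy.pow_pow _ _).orderOf_mul_eq_mul_orderOf_of_coprime (by rwa [h₁, h₂]), h₁, h₂]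

/-- Sylow subgroups of the Frattini subgroup of a finite group are normal. -/
theorem Sylow.normal_map_frattini_subtype {G : Type*} [Group G] [Finite G] {r : ℕ}
    [Fact r.Prime] (S : Sylow r (frattini G)) :
    ((S : Subgroup (frattini G)).map (frattini G).subtype).Normal :=
  Subgroup.normalizer_eq_top_iff.mp (frattini_nongenerating (Sylow.normalizer_sup_eq_top S))

/-- A minimal normal subgroup of prime power order is abelian. -/
theorem IsMinimalNormal.isMulCommutative_of_isPGroup {p : ℕ} [Fact p.Prime] {G : Type*} [Group G]
    [Finite G] {P : Subgroup G} (hmin : IsMinimalNormal P) (hP : IsPGroup p P) :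
    IsMulCommutative P := by
  have := hmin.1
  have : Nontrivial P := (Subgroup.nontrivial_iff_ne_bot P).mpr hmin.2.1
  have hne : (Subgroup.center P).map P.subtype ≠ ⊥ := by
    rw [Ne, Subgroup.map_eq_bot_iff_of_injective _ P.subtype_injective]
    exact hP.bot_lt_center.ne'
  have heq := (hmin.2.2 ((Subgroup.center P).map P.subtype) inferInstance
    (Subgroup.map_subtype_le _)).resolve_left hne
  refine ⟨⟨fun a b => ?_⟩⟩
  obtain ⟨c, hc, hca⟩ : (a : G) ∈ (Subgroup.center P).map P.subtype := by
    rw [heq]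
    exact a.2
  obtain rfl : c = a := Subtype.ext hca
  exact (Subgroup.mem_center_iff.mp hc b).symm

/-- Nontrivial disjoint normal subgroups `P` and `Q` of orders powers of `p` and of `q`, which
generate the Frattini subgroup of `G`, such that no proper quotient of `G` has commuting elements
of orders divisible by `p` and by `q`. -/
structure IsFrattiniPair (p q : ℕ) {G : Type*} [Group G] (P Q : Subgroup G) : Prop where
  prime_left : p.Prime
  prime_right : q.Prime
  ne : p ≠ q
  normal_left : P.Normal
  normal_right : Q.Normal
  isPGroup_left : IsPGroup p P
  isPGroup_right : IsPGroup q Q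
  ne_bot_left : P ≠ ⊥
  ne_bot_right : Q ≠ ⊥
  sup_eq : P ⊔ Q = frattini G
  not_dvd_orderOf : ∀ (N : Subgroup G) [N.Normal], N ≠ ⊥ → ∀ x y : G ⧸ N, Commute x y →
    p ∣ orderOf x → ¬ q ∣ orderOf y

namespace IsFrattiniPair

variable {p q : ℕ} {G : Type*} [Group G] {P Q : Subgroup G}

theorem symm (h : IsFrattiniPair p q P Q) : IsFrattiniPair q p Q P where
  prime_left := h.prime_right
  prime_right := h.prime_left
  ne := h.ne.symm
  normal_left := h.normal_right
  normal_right := h.normal_left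
  isPGroup_left := h.isPGroup_right
  isPGroup_right := h.isPGroup_left
  ne_bot_left := h.ne_bot_right
  ne_bot_right := h.ne_bot_left
  sup_eq := sup_comm P Q ▸ h.sup_eq
  not_dvd_orderOf N _ hN x y hxy hx hy := h.not_dvd_orderOf N hN y x hxy.symm hy hx

theorem inf_eq_bot (h : IsFrattiniPair p q P Q) : P ⊓ Q = ⊥ :=
  have := Fact.mk h.prime_left
  have := Fact.mk h.prime_right
  (IsPGroup.disjoint_of_ne p q h.ne P Q h.isPGroup_left h.isPGroup_right).eq_bot

theorem commute (h : IsFrattiniPair p q P Q) {x y : G} (hx : x ∈ P) (hy : y ∈ Q) : Commute x y :=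
  Subgroup.commute_of_normal_of_disjoint P Q h.normal_left h.normal_right
    (disjoint_iff.mpr h.inf_eq_bot) x y hx hy

theorem dvd_orderOf_mk (h : IsFrattiniPair p q P Q) {N : Subgroup G} [N.Normal] {x : G}
    (hx : x ∈ P) (hxN : x ∉ N) : p ∣ orderOf (QuotientGroup.mk' N x) :=
  have := Fact.mk h.prime_left
  Subgroup.orderOf_mk (QuotientGroup.mk' N x) (Subgroup.mem_map_of_mem _ hx) ▸
    (h.isPGroup_left.map (QuotientGroup.mk' N)).dvd_orderOf
      fun h1 => hxN ((QuotientGroup.eq_one_iff x).mp (congrArg Subtype.val h1))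

theorem le_or_le (h : IsFrattiniPair p q P Q) {N : Subgroup G} [N.Normal] (hN : N ≠ ⊥) :
    P ≤ N ∨ Q ≤ N := by
  by_contra! hle
  obtain ⟨x, hxP, hxN⟩ := SetLike.not_le_iff_exists.mp hle.1
  obtain ⟨y, hyQ, hyN⟩ := SetLike.not_le_iff_exists.mp hle.2
  exact h.not_dvd_orderOf N hN _ _ ((h.commute hxP hyQ).map (QuotientGroup.mk' N))
    (h.dvd_orderOf_mk hxP hxN) (h.symm.dvd_orderOf_mk hyQ hyN)

theorem isMinimalNormal (h : IsFrattiniPair p q P Q) : IsMinimalNormal P := by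
  refine ⟨h.normal_left, h.ne_bot_left, fun M hM hMP => or_iff_not_imp_left.mpr fun hne => ?_⟩
  refine hMP.antisymm ((h.le_or_le hne).resolve_right fun hQM => h.ne_bot_right ?_)
  rw [eq_bot_iff, ← h.inf_eq_bot]
  exact le_inf (hQM.trans hMP) le_rfl

theorem eq_or_eq (h : IsFrattiniPair p q P Q) {N : Subgroup G} (hN : IsMinimalNormal N) :
    N = P ∨ N = Q := by
  have := hN.1
  refine (h.le_or_le hN.2.1).imp (fun hle => ?_) fun hle => ?_
  · exact ((hN.2.2 P h.normal_left hle).resolve_left h.ne_bot_left).symm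
  · exact ((hN.2.2 Q h.normal_right hle).resolve_left h.ne_bot_right).symm

variable [Finite G]

theorem le_centralizer_self (h : IsFrattiniPair p q P Q) : P ≤ Subgroup.centralizer (P : Set G) :=
  have := Fact.mk h.prime_left
  Subgroup.le_centralizer_iff_isMulCommutative.mpr
    (h.isMinimalNormal.isMulCommutative_of_isPGroup h.isPGroup_left)

theorem frattini_le_centralizer (h : IsFrattiniPair p q P Q) :
    frattini G ≤ Subgroup.centralizer (P : Set G) := by
  rw [← h.sup_eq]
  exact sup_le h.le_centralizer_self fun y hy =>
    Subgroup.mem_centralizer_iff.mpr fun x hx => h.commute hx hy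

theorem isMulCommutative_frattini (h : IsFrattiniPair p q P Q) :
    IsMulCommutative (frattini G) := by
  rw [← Subgroup.le_centralizer_iff_isMulCommutative]
  conv_lhs => rw [← h.sup_eq]
  exact sup_le (Subgroup.le_centralizer_iff.mp h.frattini_le_centralizer)
    (Subgroup.le_centralizer_iff.mp h.symm.frattini_le_centralizer)

theorem not_dvd_relIndex (h : IsFrattiniPair p q P Q) {C : Subgroup G}
    (hC : C ≤ Subgroup.centralizer (P : Set G)) : ¬ q ∣ Q.relIndex C := by
  intro hdvd
  have := Fact.mk h.prime_right
  have := h.normal_right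
  nth_rewrite 1 [← QuotientGroup.ker_mk' Q] at hdvd
  rw [Subgroup.relIndex_ker] at hdvd
  obtain ⟨⟨y, hy⟩, hcq⟩ := exists_prime_orderOf_dvd_card' q hdvd
  rw [Subgroup.orderOf_mk] at hcq
  obtain ⟨c, hc, rfl⟩ := hy
  obtain ⟨x, hxP, hx1⟩ := P.bot_or_exists_ne_one.resolve_left h.ne_bot_left
  have hxQ : x ∉ Q := fun hxQ => hx1 <| by
    have : x ∈ P ⊓ Q := ⟨hxP, hxQ⟩
    rwa [h.inf_eq_bot, Subgroup.mem_bot] at this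
  exact h.not_dvd_orderOf Q h.ne_bot_right _ _
    (Commute.map (Subgroup.mem_centralizer_iff.mp (hC hc) x hxP) (QuotientGroup.mk' Q))
    (h.dvd_orderOf_mk hxP hxQ) hcq.symm.dvd

theorem coprime_card_relIndex (h : IsFrattiniPair p q P Q) {C : Subgroup G}
    (hC : C ≤ Subgroup.centralizer (P : Set G)) : (Nat.card Q).Coprime (Q.relIndex C) := by
  have := Fact.mk h.prime_right
  obtain ⟨k, hk⟩ := IsPGroup.iff_card.mp h.isPGroup_right
  rw [hk]
  exact ((Nat.Prime.coprime_iff_not_dvd h.prime_right).mpr (h.not_dvd_relIndex hC)).pow_left k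

theorem le_frattini_of_le_centralizer (h : IsFrattiniPair p q P Q) {D : Subgroup G} [D.Normal]
    (hDP : D ≤ Subgroup.centralizer (P : Set G)) (hDQ : D ≤ Subgroup.centralizer (Q : Set G)) :
    D ≤ frattini G := by
  have := h.isMulCommutative_frattini
  have hPF : P ≤ frattini G := h.sup_eq ▸ le_sup_left
  have hQF : Q ≤ frattini G := h.sup_eq ▸ le_sup_right
  set D' := D ⊔ frattini G
  have hDP' : D' ≤ Subgroup.centralizer (P : Set G) := sup_le hDP h.frattini_le_centralizer
  have hDQ' : D' ≤ Subgroup.centralizer (Q : Set G) := sup_le hDQ h.symm.frattini_le_centralizer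
  have hcop : (Nat.card (frattini G)).Coprime ((frattini G).relIndex D') := by
    have := h.normal_left
    have hcard : Nat.card (frattini G) ∣ Nat.card P * Nat.card Q := by
      rw [← h.sup_eq, ← Subgroup.relIndex_bot_left (P ⊔ Q),
        ← Subgroup.relIndex_mul_relIndex ⊥ P (P ⊔ Q) bot_le le_sup_left,
        Subgroup.relIndex_bot_left, Subgroup.relIndex_sup_left]
      exact mul_dvd_mul_left _ (Subgroup.relIndex_dvd_card P Q)
    refine Nat.Coprime.coprime_dvd_left hcard (Nat.Coprime.mul_left ?_ ?_)
    · exact (h.symm.coprime_card_relIndex hDQ').coprime_dvd_right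
        (Subgroup.relIndex_dvd_of_le_left D' hPF)
    · exact (h.coprime_card_relIndex hDP').coprime_dvd_right
        (Subgroup.relIndex_dvd_of_le_left D' hQF)
  obtain ⟨L, hL, hinf, hsup⟩ :=
    exists_normal_complement_of_le_frattini le_rfl le_sup_right hcop
  have hbot : L = ⊥ := by
    by_contra hne
    rcases h.le_or_le hne with hle | hle
    · exact h.ne_bot_left (eq_bot_iff.mpr (hinf ▸ le_inf hPF hle))
    · exact h.ne_bot_right (eq_bot_iff.mpr (hinf ▸ le_inf hQF hle))
  rw [hbot, sup_bot_eq] at hsup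
  exact le_sup_left.trans hsup.ge

theorem centralizer_eq (h : IsFrattiniPair p q P Q) :
    Subgroup.centralizer (P : Set G) = frattini G := by
  have := h.normal_left
  have := h.normal_right
  have := Fact.mk h.prime_right
  have := h.symm.isMinimalNormal.isMulCommutative_of_isPGroup h.isPGroup_right
  have hQF : Q ≤ frattini G := h.sup_eq ▸ le_sup_right
  refine le_antisymm ?_ h.frattini_le_centralizer
  obtain ⟨K, hK, hinf, hsup⟩ := exists_normal_complement_of_le_frattini hQF
    (hQF.trans h.frattini_le_centralizer) (h.coprime_card_relIndex le_rfl)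
  rw [← hsup]
  refine sup_le hQF (h.le_frattini_of_le_centralizer (hsup ▸ le_sup_right) fun k hk => ?_)
  exact Subgroup.mem_centralizer_iff.mpr fun x hx =>
    Subgroup.commute_of_normal_of_disjoint Q K ‹_› hK (disjoint_iff.mpr hinf) x k hx hk

end IsFrattiniPair

/-- In a group of minimal order among those satisfying `OmegaBad p q`, no proper quotient has
elements of order divisible by `p * q`. -/
theorem OmegaBad.not_dvd_orderOf_of_minimal {p q : ℕ} {G : Type*} [Group G] [Finite G]
    (hp : p.Prime) (hq : q.Prime) (hbad : OmegaBad p q G)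
    (hmin : ∀ N : Subgroup G, ∀ [N.Normal], OmegaBad p q (G ⧸ N) → Nat.card G ≤ Nat.card (G ⧸ N))
    (N : Subgroup G) [N.Normal] (hN : N ≠ ⊥) (x : G ⧸ N) : ¬ p * q ∣ orderOf x := by
  intro hx
  have hle := hmin N (hbad.quotient hp hq N hx)
  rw [Subgroup.card_eq_card_quotient_mul_card_subgroup N] at hle
  have hlt := (Subgroup.one_lt_card_iff_ne_bot N).mpr hN
  exact hle.not_gt (lt_mul_of_one_lt_right Nat.card_pos hlt)

/-- Let `p, q` be distinct odd primes and `G` a finite group of minimal order subject to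
`Ω_{p,q}(G) ≠ ∅` and `Ω**_{p,q}(G) = ∅`.  Then `Frat(G) = P × Q`, where `P` and `Q` are
the (normal) Sylow `p`- and `q`-subgroups of `Frat(G)`; `P` and `Q` are the unique
minimal normal subgroups of `G`; and `C_G(P) = C_G(Q) = Frat(G)` (so in particular `P`
and `Q` are faithful irreducible modules for `X = G/Frat(G)`). -/
theorem minimal_omegaBad_structure.{u}
    (G : Type u) [Group G] [Finite G] (p q : ℕ)
    (hp : p.Prime) (hq : q.Prime) (hpodd : Odd p) (hqodd : Odd q) (hpq : p ≠ q)
    (hbad : OmegaBad p q G)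
    (hmin : ∀ (H : Type u) [Group H] [Finite H], OmegaBad p q H → Nat.card G ≤ Nat.card H) :
    ∃ P Q : Subgroup G,
      IsPGroup p P ∧ IsPGroup q Q ∧
      P ⊔ Q = frattini G ∧ P ⊓ Q = ⊥ ∧
      IsMinimalNormal P ∧ IsMinimalNormal Q ∧
      (∀ N : Subgroup G, IsMinimalNormal N → N = P ∨ N = Q) ∧
      Subgroup.centralizer (P : Set G) = frattini G ∧
      Subgroup.centralizer (Q : Set G) = frattini G := by
  have := Fact.mk hp
  have := Fact.mk hq
  have hcop : p.Coprime q := (Nat.coprime_primes hp hq).mpr hpq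
  have hquot := hbad.not_dvd_orderOf_of_minimal hp hq (fun N _ h => hmin (G ⧸ N) h)
  obtain ⟨⟨g, hg⟩, hfrat⟩ := hbad
  have hpqF : p * q ∣ Nat.card (frattini G) := by
    have h := orderOf_pow_orderOf_div (orderOf_pos g).ne' hg
    have hmem : g ^ (orderOf g / (p * q)) ∈ frattini G := by
      refine hfrat _ ⟨h.symm.dvd, fun r hr hd => ?_⟩
      rw [h, hr.dvd_mul] at hd
      exact hd.imp (Nat.prime_dvd_prime_iff_eq hr hp).mp (Nat.prime_dvd_prime_iff_eq hr hq).mp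
    rw [← h]
    exact Subgroup.orderOf_dvd_natCard _ hmem
  have hne : ∀ r : ℕ, [Fact r.Prime] → r ∣ Nat.card (frattini G) → ∀ S : Sylow r (frattini G),
      (S : Subgroup (frattini G)).map (frattini G).subtype ≠ ⊥ := by
    intro r _ hr S
    rw [Ne, Subgroup.map_eq_bot_iff_of_injective _ (frattini G).subtype_injective]
    exact S.ne_bot_of_dvd_card hr
  have hprimes : ∀ r : ℕ, r.Prime → r ∣ Nat.card (frattini G) → r = p ∨ r = q := by
    intro r hr hrF
    by_contra! hrpq
    have := Fact.mk hr
    let S : Sylow r (frattini G) := default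
    let R := (S : Subgroup (frattini G)).map (frattini G).subtype
    have hR : R.Normal := S.normal_map_frattini_subtype
    refine hquot R (hne r hrF S) (QuotientGroup.mk' R g) ?_
    set a := orderOf (QuotientGroup.mk' R g)
    have hmem : g ^ a ∈ R := by
      rw [← QuotientGroup.eq_one_iff]
      exact pow_orderOf_eq_one (QuotientGroup.mk' R g)
    obtain ⟨k, hk⟩ := IsPGroup.iff_card.mp (S.isPGroup'.map (frattini G).subtype)
    have hdvd : orderOf g ∣ a * r ^ k := by
      rw [orderOf_dvd_iff_pow_eq_one, pow_mul, ← orderOf_dvd_iff_pow_eq_one, ← hk]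
      exact Subgroup.orderOf_dvd_natCard R hmem
    refine Nat.Coprime.dvd_of_dvd_mul_right (Nat.Coprime.pow_right k ?_) (hg.trans hdvd)
    exact Nat.Coprime.mul_left ((Nat.coprime_primes hp hr).mpr hrpq.1.symm)
      ((Nat.coprime_primes hq hr).mpr hrpq.2.symm)
  let P : Sylow p (frattini G) := default
  let Q : Sylow q (frattini G) := default
  have hsup : (P ⊔ Q : Subgroup (frattini G)) = ⊤ := by
    by_contra htop
    obtain ⟨r, hr, hdvd⟩ := Nat.exists_prime_and_dvd (mt Subgroup.index_eq_one.mp htop)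
    rcases hprimes r hr (hdvd.trans (Subgroup.index_dvd_card _)) with rfl | rfl
    · exact P.not_dvd_index (hdvd.trans (Subgroup.index_dvd_of_le le_sup_left))
    · exact Q.not_dvd_index (hdvd.trans (Subgroup.index_dvd_of_le le_sup_right))
  have h : IsFrattiniPair p q ((P : Subgroup (frattini G)).map (frattini G).subtype)
      ((Q : Subgroup (frattini G)).map (frattini G).subtype) :=
    { prime_left := hp
      prime_right := hq
      ne := hpq
      normal_left := P.normal_map_frattini_subtype
      normal_right := Q.normal_map_frattini_subtype
      isPGroup_left := P.isPGroup'.map _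
      isPGroup_right := Q.isPGroup'.map _
      ne_bot_left := hne p (dvd_of_mul_right_dvd hpqF) P
      ne_bot_right := hne q (dvd_of_mul_left_dvd hpqF) Q
      sup_eq := by
        rw [← Subgroup.map_sup, hsup, ← MonoidHom.range_eq_map, Subgroup.range_subtype]
      not_dvd_orderOf := fun N _ hN x y hxy hx hy =>
        have ⟨z, hz⟩ := exists_mul_dvd_orderOf_of_commute hcop hxy hx hy
        hquot N hN z hz }
  exact ⟨_, _, h.isPGroup_left, h.isPGroup_right, h.sup_eq, h.inf_eq_bot, h.isMinimalNormal,
    h.symm.isMinimalNormal, fun N hN => h.eq_or_eq hN, h.centralizer_eq, h.symm.centralizer_eq⟩
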